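/- (Lower bound of the new energy-dissipation balance.) Let u : [0,T] → ℝ^d be of bounded variation (so u admits one-sided limits u(t⁻), u(t⁺) at every point and its jump set J is countable). If −D_x E(t,u(t)) ∈ ∂Ψ(0) for almost every t ∈ (0,T), then for all 0 ≤ t₀ < t₁ ≤ T: E(t₁,u(t₁)) − E(t₀,u(t₀)) ≥ ∫_{t₀}^{t₁} ∂_t E(s,u(s)) ds − Diss_new(u;[t₀,t₁]). -/

import Mathlib

open Filter MeasureTheory Set
open scoped Topology NNReal

section Setup

variable {X : Type*} [NormedAddCommGroup X] [NormedSpace ℝ X]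

/-- The set of partition sums defining the `Ψ`-dissipation of `u` on `[a,b]`:
sums `∑ Ψ(u(s_i) − u(s_{i−1}))` over finite strictly increasing partitions
`a = s₀ < s₁ < ⋯ < s_n = b`. -/
def dissSums (Ψ : X → ℝ) (u : ℝ → X) (a b : ℝ) : Set ℝ :=
  { S | ∃ (n : ℕ) (σ : Fin (n + 1) → ℝ), StrictMono σ ∧ σ 0 = a ∧ σ (Fin.last n) = b ∧
      S = ∑ i : Fin n, Ψ (u (σ i.succ) - u (σ i.castSucc)) }

/-- The `Ψ`-dissipation `Diss_Ψ(u;[a,b])`. -/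
noncomputable def dissTV (Ψ : X → ℝ) (u : ℝ → X) (a b : ℝ) : ℝ :=
  sSup (dissSums Ψ u a b)

/-- The subdifferential `∂Ψ(0) = {η : ⟨η,v⟩ ≤ Ψ(v) for all v}`. -/
def subdiffZero (Ψ : X → ℝ) : Set (X →L[ℝ] ℝ) :=
  { η | ∀ v, η v ≤ Ψ v }

/-- `inf_{η ∈ ∂Ψ(0)} ‖ξ + η‖_*`, where `‖·‖_*` is the dual (operator) norm. -/
noncomputable def distToSubdiff (Ψ : X → ℝ) (ξ : X →L[ℝ] ℝ) : ℝ :=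
  sInf ((fun η => ‖ξ + η‖) '' subdiffZero Ψ)

/-- The cost `Δ_new(t;a,b)`: infimum over Lipschitz paths `γ : [0,1] → X` with
`γ(0)=a`, `γ(1)=b` of `∫₀¹ Ψ(γ'(s)) + (inf_{z∈∂Ψ(0)} ‖D_xE(t,γ(s))+z‖_*)·‖γ'(s)‖ ds`. -/
noncomputable def deltaNew (DE : ℝ → X → X →L[ℝ] ℝ) (Ψ : X → ℝ) (t : ℝ) (a b : X) : ℝ :=
  sInf { c | ∃ (K : ℝ≥0) (γ : ℝ → X), LipschitzOnWith K γ (Icc 0 1) ∧ γ 0 = a ∧ γ 1 = b ∧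
      c = ∫ s in (0:ℝ)..1, (Ψ (deriv γ s) + distToSubdiff Ψ (DE t (γ s)) * ‖deriv γ s‖) }

/-- The new dissipation `Diss_new(u;[t₁,t₂])`, with prescribed one-sided limit
functions `uL`, `uR`, summing over the jump set the corrections `Δ_new − Ψ`. -/
noncomputable def dissNew (DE : ℝ → X → X →L[ℝ] ℝ) (Ψ : X → ℝ)
    (u uL uR : ℝ → X) (t₁ t₂ : ℝ) : ℝ :=
  dissTV Ψ u t₁ t₂
    + ∑' t : ({ s | ¬ ContinuousAt u s } ∩ Ioo t₁ t₂ : Set ℝ),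
        (deltaNew DE Ψ (t : ℝ) (uL (t : ℝ)) (u (t : ℝ)) +
          deltaNew DE Ψ (t : ℝ) (u (t : ℝ)) (uR (t : ℝ))
          - Ψ (u (t : ℝ) - uL (t : ℝ)) - Ψ (uR (t : ℝ) - u (t : ℝ)))
    + (deltaNew DE Ψ t₁ (u t₁) (uR t₁) - Ψ (uR t₁ - u t₁))
    + (deltaNew DE Ψ t₂ (uL t₂) (u t₂) - Ψ (u t₂ - uL t₂))

/-- `pts` is a discretized solution with initial datum `x₀`, neighborhood size `ε`,
time-step `τ` and `N` steps: `pts 0 = x₀` and each `pts i` minimizes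
`x ↦ E(iτ, x) + Ψ(x − pts (i−1))` over the closed ball of radius `ε` around `pts (i−1)`. -/
def IsDiscreteSol (E : ℝ → X → ℝ) (Ψ : X → ℝ) (x₀ : X) (ε τ : ℝ) (N : ℕ)
    (pts : ℕ → X) : Prop :=
  pts 0 = x₀ ∧ ∀ i : ℕ, 1 ≤ i → i ≤ N →
    ‖pts i - pts (i - 1)‖ ≤ ε ∧
    ∀ x : X, ‖x - pts (i - 1)‖ ≤ ε →
      E ((i : ℝ) * τ) (pts i) + Ψ (pts i - pts (i - 1)) ≤
        E ((i : ℝ) * τ) x + Ψ (x - pts (i - 1))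

/-- The piecewise-constant interpolant `x^{ε,τ}`: equal to `pts (i−1)` on
`[(i−1)τ, iτ)` for `i = 1,…,N`, and to `pts N` on `[Nτ, T]`. -/
noncomputable def discInterp (pts : ℕ → X) (τ : ℝ) (N : ℕ) (t : ℝ) : X :=
  pts (min N ⌊t / τ⌋₊)

end Setup

section Dissipation

variable {X : Type*} [NormedAddCommGroup X] [NormedSpace ℝ X] {Ψ : X → ℝ}

lemma zero_mem_subdiffZero (hΨnn : ∀ v, 0 ≤ Ψ v) : (0 : X →L[ℝ] ℝ) ∈ subdiffZero Ψ :=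
  fun v => by simpa using hΨnn v

lemma distToSubdiff_nonneg (ξ : X →L[ℝ] ℝ) : 0 ≤ distToSubdiff Ψ ξ := by
  apply Real.sInf_nonneg
  rintro _ ⟨η, -, rfl⟩
  exact norm_nonneg _

lemma distToSubdiff_le_norm (hΨnn : ∀ v, 0 ≤ Ψ v) (ξ : X →L[ℝ] ℝ) :
    distToSubdiff Ψ ξ ≤ ‖ξ‖ := by
  refine csInf_le ⟨0, ?_⟩ ⟨0, zero_mem_subdiffZero hΨnn, by simp⟩
  rintro _ ⟨η, -, rfl⟩
  exact norm_nonneg _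

lemma distToSubdiff_eq_infDist (ξ : X →L[ℝ] ℝ) :
    distToSubdiff Ψ ξ = Metric.infDist (-ξ) (subdiffZero Ψ) := by
  rw [distToSubdiff, Metric.infDist_eq_iInf, sInf_image']
  congr 1
  ext η
  rw [dist_eq_norm, ← norm_neg]
  congr 1
  abel

lemma continuous_distToSubdiff : Continuous (distToSubdiff Ψ) := by
  have : distToSubdiff Ψ = fun ξ => Metric.infDist (-ξ) (subdiffZero Ψ) :=
    funext distToSubdiff_eq_infDist
  rw [this]
  exact (Metric.continuous_infDist_pt _).comp continuous_neg

/-- The integrand of the transition cost dominates the energy release rate. -/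
lemma neg_apply_le_add_distToSubdiff_mul (hΨnn : ∀ v, 0 ≤ Ψ v) (ξ : X →L[ℝ] ℝ) (v : X) :
    -(ξ v) ≤ Ψ v + distToSubdiff Ψ ξ * ‖v‖ := by
  rcases eq_or_ne v 0 with rfl | hv
  · simpa using hΨnn 0
  have hv' : 0 < ‖v‖ := norm_pos_iff.2 hv
  have : (-(ξ v) - Ψ v) / ‖v‖ ≤ distToSubdiff Ψ ξ := by
    refine le_csInf ⟨_, 0, zero_mem_subdiffZero hΨnn, rfl⟩ ?_
    rintro _ ⟨η, hη, rfl⟩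
    rw [div_le_iff₀ hv']
    have h1 := (neg_le_abs _).trans ((ξ + η).le_opNorm v)
    have h2 := hη v
    rw [add_apply] at h1
    linarith
  rw [div_le_iff₀ hv'] at this
  linarith

lemma exists_le_mul_norm [FiniteDimensional ℝ X] (hΨc : Continuous Ψ)
    (hΨhom : ∀ c : ℝ, 0 ≤ c → ∀ v : X, Ψ (c • v) = c * Ψ v) :
    ∃ C, 0 ≤ C ∧ ∀ v, Ψ v ≤ C * ‖v‖ := by
  have := FiniteDimensional.proper ℝ X
  obtain ⟨C, hC⟩ := (isCompact_closedBall (0 : X) 1).bddAbove_image hΨc.continuousOn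
  have h0 : Ψ 0 = 0 := by simpa using hΨhom 0 le_rfl 0
  have hC0 : 0 ≤ C := h0 ▸ hC ⟨0, by simp, rfl⟩
  refine ⟨C, hC0, fun v => ?_⟩
  rcases eq_or_ne v 0 with rfl | hv
  · simp [h0]
  have hv' : 0 < ‖v‖ := norm_pos_iff.2 hv
  have h1 : Ψ (‖v‖⁻¹ • v) ≤ C := by
    refine hC ⟨_, ?_, rfl⟩
    simp [norm_smul, hv'.ne']
  rw [hΨhom _ (by positivity), inv_mul_le_iff₀ hv'] at h1
  linarith

end Dissipation

section LipschitzPaths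

variable {X : Type*} [NormedAddCommGroup X] [NormedSpace ℝ X]
  {γ : ℝ → X} {K : ℝ≥0}

lemma LipschitzOnWith.norm_deriv_le_of_mem_Ioo (hγ : LipschitzOnWith K γ (Icc 0 1)) {s : ℝ}
    (hs : s ∈ Ioo (0 : ℝ) 1) : ‖deriv γ s‖ ≤ K :=
  norm_deriv_le_of_lipschitzOn (Icc_mem_nhds hs.1 hs.2) hγ

lemma ae_restrict_Ioc_mem_Ioo (a b : ℝ) : ∀ᵐ s ∂volume.restrict (Ioc a b), s ∈ Ioo a b := by
  rw [← restrict_Ioo_eq_restrict_Ioc]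
  exact ae_restrict_mem measurableSet_Ioo

variable [FiniteDimensional ℝ X]

lemma LipschitzOnWith.integrableOn_deriv (hγ : LipschitzOnWith K γ (Icc 0 1)) :
    IntegrableOn (deriv γ) (Ioc 0 1) := by
  have : CompleteSpace X := FiniteDimensional.complete ℝ X
  refine MeasureTheory.Integrable.of_bound (aestronglyMeasurable_deriv γ _) K ?_
  filter_upwards [ae_restrict_Ioc_mem_Ioo 0 1] with s hs
  exact hγ.norm_deriv_le_of_mem_Ioo hs

lemma LipschitzOnWith.ae_differentiableAt_Ioo (hγ : LipschitzOnWith K γ (Icc 0 1)) :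
    ∀ᵐ s, s ∈ Ioo (0 : ℝ) 1 → DifferentiableAt ℝ γ s := by
  filter_upwards [hγ.ae_differentiableWithinAt_of_mem_real] with s hs hs1
  exact (hs (Ioo_subset_Icc_self hs1)).differentiableAt (Icc_mem_nhds hs1.1 hs1.2)

lemma LipschitzOnWith.intervalIntegral_deriv_eq_sub (hγ : LipschitzOnWith K γ (Icc 0 1)) :
    ∫ s in (0 : ℝ)..1, deriv γ s = γ 1 - γ 0 := by
  have : CompleteSpace X := FiniteDimensional.complete ℝ X
  rw [← sub_eq_zero]
  refine SeparatingDual.eq_zero_of_forall_dual_eq_zero (R := ℝ) fun η => ?_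
  have hint : IntervalIntegrable (deriv γ) volume 0 1 :=
    (intervalIntegrable_iff_integrableOn_Ioc_of_le zero_le_one).2 hγ.integrableOn_deriv
  have hac := (η.lipschitz.comp_lipschitzOnWith hγ)
  rw [← uIcc_of_le (zero_le_one (α := ℝ))] at hac
  have hftc := hac.absolutelyContinuousOnInterval.integral_deriv_eq_sub
  rw [map_sub, ← η.intervalIntegral_comp_comm hint, map_sub, sub_eq_zero]
  rw [← Function.comp_apply (f := η), ← Function.comp_apply (f := η), ← hftc]
  refine intervalIntegral.integral_congr_ae ?_
  filter_upwards [hγ.ae_differentiableAt_Ioo, Measure.ae_ne volume 1] with s hs hs1 hs2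
  rw [uIoc_of_le zero_le_one] at hs2
  have h := hs ⟨hs2.1, lt_of_le_of_ne hs2.2 hs1⟩
  exact (η.hasFDerivAt.comp_hasDerivAt s h.hasDerivAt).deriv.symm

end LipschitzPaths

section TransitionCost

variable {X : Type*} [NormedAddCommGroup X] [NormedSpace ℝ X]
  {Ψ : X → ℝ} {DE : ℝ → X → X →L[ℝ] ℝ} {t : ℝ}

lemma deltaNew_bddBelow (hΨnn : ∀ v, 0 ≤ Ψ v) (a b : X) : BddBelow
    { c | ∃ (K : ℝ≥0) (γ : ℝ → X), LipschitzOnWith K γ (Icc 0 1) ∧ γ 0 = a ∧ γ 1 = b ∧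
      c = ∫ s in (0:ℝ)..1, (Ψ (deriv γ s) + distToSubdiff Ψ (DE t (γ s)) * ‖deriv γ s‖) } := by
  refine ⟨0, ?_⟩
  rintro _ ⟨K, γ, -, -, -, rfl⟩
  refine intervalIntegral.integral_nonneg zero_le_one fun s _ => ?_
  have := hΨnn (deriv γ s)
  have := mul_nonneg (distToSubdiff_nonneg (Ψ := Ψ) (DE t (γ s))) (norm_nonneg (deriv γ s))
  linarith

lemma lipschitzOnWith_segment (a b : X) :
    LipschitzOnWith ‖b - a‖₊ (fun s : ℝ => a + s • (b - a)) (Icc 0 1) := by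
  refine LipschitzOnWith.of_dist_le_mul fun x _ y _ => ?_
  rw [dist_add_left, dist_eq_norm, ← sub_smul, norm_smul, Real.dist_eq, coe_nnnorm, mul_comm,
    Real.norm_eq_abs]

lemma deltaNew_le (hΨnn : ∀ v, 0 ≤ Ψ v) (a b : X) {M : ℝ}
    (hM : ∀ x ∈ segment ℝ a b, ‖DE t x‖ ≤ M) :
    deltaNew DE Ψ t a b ≤ Ψ (b - a) + M * ‖b - a‖ := by
  refine (csInf_le (deltaNew_bddBelow hΨnn a b)
    ⟨_, _, lipschitzOnWith_segment a b, by simp, by simp, rfl⟩).trans ?_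
  have hd : ∀ s : ℝ, deriv (fun s : ℝ => a + s • (b - a)) s = b - a := fun s => by
    have := ((hasDerivAt_id s).smul_const (b - a)).const_add a
    simpa using this.deriv
  simp only [hd]
  refine (Real.le_norm_self _).trans ?_
  refine (intervalIntegral.norm_integral_le_of_norm_le_const (a := 0) (b := 1)
    (C := Ψ (b - a) + M * ‖b - a‖) fun s hs => ?_).trans ?_
  swap
  · simp
  rw [uIoc_of_le zero_le_one] at hs
  have h1 := distToSubdiff_nonneg (Ψ := Ψ) (DE t (a + s • (b - a)))
  have h2 := (distToSubdiff_le_norm hΨnn (DE t (a + s • (b - a)))).trans (hM _ <| by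
    rw [segment_eq_image']; exact ⟨s, ⟨hs.1.le, hs.2⟩, rfl⟩)
  have h3 := hΨnn (b - a)
  rw [Real.norm_of_nonneg (by positivity)]
  gcongr

variable [FiniteDimensional ℝ X]

lemma integrableOn_comp_deriv {γ : ℝ → X} {K : ℝ≥0} (hΨnn : ∀ v, 0 ≤ Ψ v) (hΨc : Continuous Ψ)
    (hΨhom : ∀ c : ℝ, 0 ≤ c → ∀ v : X, Ψ (c • v) = c * Ψ v)
    (hγ : LipschitzOnWith K γ (Icc 0 1)) :
    IntegrableOn (fun s => Ψ (deriv γ s)) (Ioc 0 1) := by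
  have : CompleteSpace X := FiniteDimensional.complete ℝ X
  obtain ⟨C, hC0, hC⟩ := exists_le_mul_norm hΨc hΨhom
  refine MeasureTheory.Integrable.of_bound
    (hΨc.comp_aestronglyMeasurable (aestronglyMeasurable_deriv γ _)) (C * K) ?_
  filter_upwards [ae_restrict_Ioc_mem_Ioo 0 1] with s hs
  rw [Real.norm_of_nonneg (hΨnn _)]
  exact (hC _).trans (mul_le_mul_of_nonneg_left (hγ.norm_deriv_le_of_mem_Ioo hs) hC0)

lemma intervalIntegrable_transitionCost {γ : ℝ → X} {K : ℝ≥0} (hΨnn : ∀ v, 0 ≤ Ψ v)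
    (hΨc : Continuous Ψ) (hΨhom : ∀ c : ℝ, 0 ≤ c → ∀ v : X, Ψ (c • v) = c * Ψ v)
    (hDE : Continuous (DE t)) (hγ : LipschitzOnWith K γ (Icc 0 1)) :
    IntervalIntegrable (fun s => Ψ (deriv γ s) + distToSubdiff Ψ (DE t (γ s)) * ‖deriv γ s‖)
      volume 0 1 := by
  rw [intervalIntegrable_iff_integrableOn_Ioc_of_le zero_le_one]
  refine (integrableOn_comp_deriv hΨnn hΨc hΨhom hγ).add ?_
  have hc : ContinuousOn (fun s => distToSubdiff Ψ (DE t (γ s))) (Icc 0 1) :=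
    (continuous_distToSubdiff.comp hDE).comp_continuousOn hγ.continuousOn
  obtain ⟨M, hM⟩ := isCompact_Icc.exists_bound_of_continuousOn hc
  refine hγ.integrableOn_deriv.norm.bdd_mul (c := M)
    ((hc.mono Ioc_subset_Icc_self).aestronglyMeasurable measurableSet_Ioc) ?_
  filter_upwards [ae_restrict_Ioc_mem_Ioo 0 1] with s hs
  exact hM s (Ioo_subset_Icc_self hs)

lemma le_deltaNew (hΨconv : ConvexOn ℝ univ Ψ) (hΨnn : ∀ v, 0 ≤ Ψ v) (hΨc : Continuous Ψ)
    (hΨhom : ∀ c : ℝ, 0 ≤ c → ∀ v : X, Ψ (c • v) = c * Ψ v) (hDE : Continuous (DE t)) (a b : X) :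
    Ψ (b - a) ≤ deltaNew DE Ψ t a b := by
  refine le_csInf ⟨_, _, _, lipschitzOnWith_segment a b, by simp, by simp, rfl⟩ ?_
  rintro _ ⟨K, γ, hγ, rfl, rfl, rfl⟩
  have hint := integrableOn_comp_deriv hΨnn hΨc hΨhom hγ
  have : IsProbabilityMeasure ((volume : Measure ℝ).restrict (Ioc 0 1)) := ⟨by simp⟩
  rw [← hγ.intervalIntegral_deriv_eq_sub, intervalIntegral.integral_of_le zero_le_one]
  refine (hΨconv.map_integral_le hΨc.continuousOn isClosed_univ (by simp)
    hγ.integrableOn_deriv hint).trans ?_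
  rw [← intervalIntegral.integral_of_le zero_le_one]
  refine intervalIntegral.integral_mono_on zero_le_one
    ((intervalIntegrable_iff_integrableOn_Ioc_of_le zero_le_one).2 hint)
    (intervalIntegrable_transitionCost hΨnn hΨc hΨhom hDE hγ) fun s _ => ?_
  have := mul_nonneg (distToSubdiff_nonneg (Ψ := Ψ) (DE t (γ s))) (norm_nonneg (deriv γ s))
  linarith

/-- The energy released along a transition is at most the transition cost. -/
lemma sub_le_deltaNew {e : X → ℝ} (hΨnn : ∀ v, 0 ≤ Ψ v) (hΨc : Continuous Ψ)
    (hΨhom : ∀ c : ℝ, 0 ≤ c → ∀ v : X, Ψ (c • v) = c * Ψ v) (hDE : Continuous (DE t))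
    (he : ∀ x, HasFDerivAt e (DE t x) x) (a b : X) :
    e a - e b ≤ deltaNew DE Ψ t a b := by
  have := FiniteDimensional.proper ℝ X
  refine le_csInf ⟨_, _, _, lipschitzOnWith_segment a b, by simp, by simp, rfl⟩ ?_
  rintro _ ⟨K, γ, hγ, rfl, rfl, rfl⟩
  obtain ⟨R, hR⟩ :=
    (isCompact_Icc.image_of_continuousOn hγ.continuousOn).isBounded.subset_closedBall (0 : X)
  obtain ⟨M, hM⟩ := (isCompact_closedBall (0 : X) R).exists_bound_of_continuousOn
    hDE.continuousOn
  have hLip : LipschitzOnWith M.toNNReal e (Metric.closedBall 0 R) :=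
    (convex_closedBall (0 : X) R).lipschitzOnWith_of_nnnorm_hasFDerivWithin_le
      (fun x _ => (he x).hasFDerivWithinAt) fun x hx => by
        rw [← NNReal.coe_le_coe, coe_nnnorm]
        exact (hM x hx).trans (Real.le_coe_toNNReal M)
  have hac := hLip.comp hγ (mapsTo_iff_image_subset.2 hR)
  rw [← uIcc_of_le (zero_le_one (α := ℝ))] at hac
  have hac := hac.absolutelyContinuousOnInterval
  have hftc := hac.integral_deriv_eq_sub
  have hle : -∫ s in (0 : ℝ)..1, deriv (e ∘ γ) s ≤
      ∫ s in (0:ℝ)..1, (Ψ (deriv γ s) + distToSubdiff Ψ (DE t (γ s)) * ‖deriv γ s‖) := by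
    rw [← intervalIntegral.integral_neg]
    refine intervalIntegral.integral_mono_ae_restrict zero_le_one hac.intervalIntegrable_deriv.neg
      (intervalIntegrable_transitionCost hΨnn hΨc hΨhom hDE hγ) ?_
    rw [Filter.EventuallyLE, ae_restrict_iff' measurableSet_Icc]
    filter_upwards [hγ.ae_differentiableAt_Ioo, Measure.ae_ne volume 1, Measure.ae_ne volume 0]
      with s hs hs1 hs0 hs2
    have h := hs ⟨lt_of_le_of_ne hs2.1 hs0.symm, lt_of_le_of_ne hs2.2 hs1⟩
    rw [((he (γ s)).comp_hasDerivAt s h.hasDerivAt).deriv]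
    exact neg_apply_le_add_distToSubdiff_mul hΨnn _ _
  rw [hftc] at hle
  simpa using hle

end TransitionCost

section PartitionSums

variable {X : Type*} [NormedAddCommGroup X] {g : X → ℝ} {u : ℝ → X} {a b s t : ℝ}

lemma dissSums_nonempty (hab : a ≤ b) : (dissSums g u a b).Nonempty := by
  rcases hab.eq_or_lt with rfl | hab
  · exact ⟨_, 0, fun _ => a, fun i j h => absurd h (by simp [Subsingleton.elim (α := Fin 1) i j]),
      rfl, rfl, rfl⟩
  · refine ⟨_, 1, ![a, b], ?_, rfl, rfl, rfl⟩
    rw [Fin.strictMono_iff_lt_succ]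
    simpa using hab

lemma add_mem_dissSums (hst : s < t) {S : ℝ} (hS : S ∈ dissSums g u a s) :
    S + g (u t - u s) ∈ dissSums g u a t := by
  obtain ⟨n, σ, hσ, h0, hn, rfl⟩ := hS
  refine ⟨n + 1, Fin.snoc (α := fun _ => ℝ) σ t, ?_, ?_, by simp, ?_⟩
  · rw [Fin.strictMono_iff_lt_succ]
    intro i
    refine Fin.lastCases ?_ (fun j => ?_) i
    · simpa [hn] using hst
    · rw [← Fin.castSucc_succ, Fin.snoc_castSucc, Fin.snoc_castSucc]
      exact hσ (Fin.castSucc_lt_succ)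
  · rw [← Fin.castSucc_zero, Fin.snoc_castSucc, h0]
  · rw [Fin.sum_univ_castSucc]
    congr 1
    · refine Finset.sum_congr rfl fun j _ => ?_
      rw [← Fin.castSucc_succ, Fin.snoc_castSucc, Fin.snoc_castSucc]
    · simp [hn]

lemma dissTV_nonneg (hg : ∀ v, 0 ≤ g v) : 0 ≤ dissTV g u a b := by
  apply Real.sSup_nonneg
  rintro _ ⟨n, σ, -, -, -, rfl⟩
  exact Finset.sum_nonneg fun i _ => hg _

lemma bddAbove_dissSums_mono (hg : ∀ v, 0 ≤ g v) (hst : s ≤ t)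
    (h : BddAbove (dissSums g u a t)) : BddAbove (dissSums g u a s) := by
  rcases hst.eq_or_lt with rfl | hst
  · exact h
  obtain ⟨M, hM⟩ := h
  refine ⟨M, fun S hS => ?_⟩
  have := hM (add_mem_dissSums hst hS)
  linarith [hg (u t - u s)]

lemma le_dissTV_sub (has : a ≤ s) (hst : s < t) (h : BddAbove (dissSums g u a t)) :
    g (u t - u s) ≤ dissTV g u a t - dissTV g u a s := by
  have : dissTV g u a s ≤ dissTV g u a t - g (u t - u s) := by
    refine csSup_le (dissSums_nonempty has) fun S hS => ?_
    have := le_csSup h (add_mem_dissSums hst hS)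
    simp only [dissTV]
    linarith
  linarith

lemma Fin.sum_succ_sub_castSucc (n : ℕ) (f : Fin (n + 1) → ℝ) :
    ∑ i : Fin n, (f i.succ - f i.castSucc) = f (Fin.last n) - f 0 := by
  induction n with
  | zero => simp
  | succ n ih =>
    rw [Fin.sum_univ_castSucc]
    have := ih fun i => f i.castSucc
    simp only [Fin.castSucc_succ, Fin.castSucc_zero] at this
    rw [this, Fin.succ_last]
    ring

lemma bddAbove_dissSums_of_le_sub {W : ℝ → ℝ}
    (hW : ∀ s t, a ≤ s → s < t → t ≤ b → g (u t - u s) ≤ W t - W s) :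
    BddAbove (dissSums g u a b) := by
  refine ⟨W b - W a, ?_⟩
  rintro _ ⟨n, σ, hσ, h0, hn, rfl⟩
  calc ∑ i : Fin n, g (u (σ i.succ) - u (σ i.castSucc))
      ≤ ∑ i : Fin n, (W (σ i.succ) - W (σ i.castSucc)) := by
        refine Finset.sum_le_sum fun i _ => hW _ _ ?_ (hσ Fin.castSucc_lt_succ) ?_
        · rw [← h0]
          exact hσ.monotone (Fin.zero_le _)
        · rw [← hn]
          exact hσ.monotone (Fin.le_last _)
    _ = W b - W a := by
        have := Fin.sum_succ_sub_castSucc n (W ∘ σ)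
        simpa [h0, hn] using this

variable {W : ℝ → ℝ}

/-- If `W` controls the `g`-increments of `u`, then it controls the two-step increments through a
left limit of `u`. -/
lemma add_le_sub_of_tendsto_nhdsLT (hg : Continuous g)
    (hW : ∀ s t, a ≤ s → s < t → t ≤ b → g (u t - u s) ≤ W t - W s)
    (hs : a ≤ s) (hst : s < t) (ht : t ≤ b) {L : X} (hL : Tendsto u (𝓝[<] t) (𝓝 L)) :
    g (L - u s) + g (u t - L) ≤ W t - W s := by
  have h1 : Tendsto (fun r => g (u r - u s) + g (u t - u r)) (𝓝[<] t)
      (𝓝 (g (L - u s) + g (u t - L))) :=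
    ((hg.tendsto _).comp (hL.sub_const _)).add ((hg.tendsto _).comp (hL.const_sub _))
  refine le_of_tendsto h1 ?_
  filter_upwards [Ioo_mem_nhdsLT hst] with r hr
  linarith [hW s r hs hr.1 (hr.2.le.trans ht), hW r t (hs.trans hr.1.le) hr.2 ht]

/-- If `W` controls the `g`-increments of `u`, then it controls the two-step increments through a
right limit of `u`. -/
lemma add_le_sub_of_tendsto_nhdsGT (hg : Continuous g)
    (hW : ∀ s t, a ≤ s → s < t → t ≤ b → g (u t - u s) ≤ W t - W s)
    (hs : a ≤ s) (hst : s < t) (ht : t ≤ b) {R : X} (hR : Tendsto u (𝓝[>] s) (𝓝 R)) :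
    g (R - u s) + g (u t - R) ≤ W t - W s := by
  have h1 : Tendsto (fun r => g (u r - u s) + g (u t - u r)) (𝓝[>] s)
      (𝓝 (g (R - u s) + g (u t - R))) :=
    ((hg.tendsto _).comp (hR.sub_const _)).add ((hg.tendsto _).comp (hR.const_sub _))
  refine le_of_tendsto h1 ?_
  filter_upwards [Ioo_mem_nhdsGT hst] with r hr
  linarith [hW s r hs hr.1 (hr.2.le.trans ht), hW r t (hs.trans hr.1.le) hr.2 ht]

end PartitionSums

section JumpSums

variable {f W : ℝ → ℝ} {a b : ℝ}

lemma sum_le_sub_of_forall_Ico (hab : a ≤ b) (hW : MonotoneOn W (Icc a b))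
    (h : ∀ t ∈ Ioc a b, ∀ s ∈ Ico a t, f t ≤ W t - W s) (F : Finset ℝ)
    (hF : ∀ x ∈ F, x ∈ Ioc a b) : ∑ x ∈ F, f x ≤ W b - W a := by
  induction F using Finset.induction_on_min generalizing a with
  | empty => simpa using hW (left_mem_Icc.2 hab) (right_mem_Icc.2 hab) hab
  | insert m F hm ih =>
    obtain ⟨ham, hmb⟩ := hF m (Finset.mem_insert_self _ _)
    rw [Finset.sum_insert fun hmF => (hm m hmF).false]
    have h1 := ih hmb (hW.mono (Icc_subset_Icc_left ham.le))
      (fun t ht s hs => h t ⟨ham.trans ht.1, ht.2⟩ s ⟨ham.le.trans hs.1, hs.2⟩)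
      (fun x hx => ⟨hm x hx, (hF x (Finset.mem_insert_of_mem hx)).2⟩)
    linarith [h m ⟨ham, hmb⟩ a ⟨le_rfl, ham⟩]

lemma sum_le_sub_of_forall_Ioc (hab : a ≤ b) (hW : MonotoneOn W (Icc a b))
    (h : ∀ t ∈ Ico a b, ∀ s ∈ Ioc t b, f t ≤ W s - W t) (F : Finset ℝ)
    (hF : ∀ x ∈ F, x ∈ Ico a b) : ∑ x ∈ F, f x ≤ W b - W a := by
  induction F using Finset.induction_on_max generalizing b with
  | empty => simpa using hW (left_mem_Icc.2 hab) (right_mem_Icc.2 hab) hab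
  | insert m F hm ih =>
    obtain ⟨ham, hmb⟩ := hF m (Finset.mem_insert_self _ _)
    rw [Finset.sum_insert fun hmF => (hm m hmF).false]
    have h1 := ih ham (hW.mono (Icc_subset_Icc_right hmb.le))
      (fun t ht s hs => h t ⟨ht.1, ht.2.trans hmb⟩ s ⟨hs.1, hs.2.trans hmb.le⟩)
      (fun x hx => ⟨(hF x (Finset.mem_insert_of_mem hx)).1, hm x hx⟩)
    linarith [h m ⟨ham, hmb⟩ b ⟨hmb, le_rfl⟩]

lemma summable_indicator_of_sum_le {A : Set ℝ} {C : ℝ} (hf : ∀ x ∈ A, 0 ≤ f x)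
    (h : ∀ F : Finset ℝ, (∀ x ∈ F, x ∈ A) → ∑ x ∈ F, f x ≤ C) : Summable (A.indicator f) := by
  classical
  refine summable_of_sum_le (c := C) (fun x => indicator_nonneg hf x) fun F => ?_
  rw [← Finset.sum_filter_of_ne (p := (· ∈ A)) fun x _ hx => mem_of_indicator_ne_zero hx,
    Finset.sum_congr rfl fun x hx => indicator_of_mem (Finset.mem_filter.1 hx).2 f]
  exact h _ fun x hx => (Finset.mem_filter.1 hx).2

lemma tsum_indicator_insert {A : Set ℝ} {x : ℝ} (hx : x ∉ A) (hA : Summable (A.indicator f)) :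
    ∑' r, (insert x A).indicator f r = ∑' r, A.indicator f r + f x := by
  have h1 : (insert x A).indicator f =
      fun r => A.indicator f r + (Pi.single x (f x) : ℝ → ℝ) r := by
    ext r
    rcases eq_or_ne r x with rfl | hr
    · simp [hx]
    · by_cases hrA : r ∈ A <;> simp [hr, hrA]
  rw [h1, hA.tsum_add (hasSum_pi_single x (f x)).summable, tsum_pi_single]

lemma summable_indicator_mono {A B : Set ℝ} (hAB : A ⊆ B) (hB : Summable (B.indicator f)) :
    Summable (A.indicator f) := by
  have := hB.indicator A
  rwa [indicator_indicator, inter_eq_left.2 hAB] at this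

lemma tsum_indicator_mono {A B : Set ℝ} (hf : ∀ r ∈ B, 0 ≤ f r) (hAB : A ⊆ B)
    (hB : Summable (B.indicator f)) : ∑' r, A.indicator f r ≤ ∑' r, B.indicator f r := by
  refine (summable_indicator_mono hAB hB).tsum_le_tsum (fun r => ?_) hB
  rw [← inter_eq_left.2 hAB, ← indicator_indicator]
  exact indicator_le_self' (fun x _ => indicator_nonneg hf x) r

lemma tsum_indicator_add_le {A B : Set ℝ} {x : ℝ} (hf : ∀ r ∈ B, 0 ≤ f r)
    (hB : Summable (B.indicator f)) (hAB : A ⊆ B) (hxA : x ∉ A) (hxB : x ∈ B) :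
    ∑' r, A.indicator f r + f x ≤ ∑' r, B.indicator f r := by
  rw [← tsum_indicator_insert hxA (summable_indicator_mono hAB hB)]
  exact tsum_indicator_mono hf (insert_subset hxB hAB) hB

end JumpSums

section LocalMonotonicity

/-- One-sided local monotonicity at every point of an interval implies monotonicity from end to
end. -/
lemma le_of_eventually_le_nhdsLT_nhdsGT {Φ : ℝ → ℝ} {a b : ℝ} (hab : a ≤ b)
    (hl : ∀ t ∈ Ioc a b, ∀ᶠ s in 𝓝[<] t, a ≤ s → Φ s ≤ Φ t)
    (hr : ∀ t ∈ Ico a b, ∀ᶠ s in 𝓝[>] t, s ≤ b → Φ t ≤ Φ s) : Φ a ≤ Φ b := by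
  set S := {t ∈ Icc a b | Φ a ≤ Φ t}
  have haS : a ∈ S := ⟨left_mem_Icc.2 hab, le_rfl⟩
  have hbdd : BddAbove S := ⟨b, fun t ht => ht.1.2⟩
  set c := sSup S
  have hac : a ≤ c := le_csSup hbdd haS
  have hcb : c ≤ b := csSup_le ⟨a, haS⟩ fun t ht => ht.1.2
  have hcS : Φ a ≤ Φ c := by
    rcases hac.eq_or_lt with h | hac
    · rw [← h]
    obtain ⟨l, hlc, hl'⟩ := mem_nhdsLT_iff_exists_Ioo_subset.1 (hl c ⟨hac, hcb⟩)
    obtain ⟨s, hs, hls⟩ := exists_lt_of_lt_csSup ⟨a, haS⟩ (show l < sSup S from hlc)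
    rcases (le_csSup hbdd hs).eq_or_lt with h | hsc
    · exact hs.2.trans_eq (congrArg Φ h)
    · exact hs.2.trans (hl' ⟨hls, hsc⟩ hs.1.1)
  rcases hcb.eq_or_lt with h | hcb
  · rwa [h] at hcS
  obtain ⟨s, hs, hcs⟩ := ((hr c ⟨hac, hcb⟩).and (Ioo_mem_nhdsGT hcb)).exists
  have hsS : s ∈ S := ⟨⟨hac.trans hcs.1.le, hcs.2.le⟩, hcS.trans (hs hcs.2.le)⟩
  exact absurd (le_csSup hbdd hsS) (not_le.2 hcs.1)

end LocalMonotonicity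

section EnergyIncrements

lemma frequently_nhdsLT_of_ae {p : ℝ → Prop} (hp : ∀ᵐ s, p s) (t : ℝ) : ∃ᶠ s in 𝓝[<] t, p s := by
  rw [frequently_iff]
  intro U hU
  obtain ⟨l, hl, hlU⟩ := mem_nhdsLT_iff_exists_Ioo_subset.1 hU
  obtain ⟨s, hs, hps⟩ := (Measure.dense_of_ae hp).inter_open_nonempty _ isOpen_Ioo
    (nonempty_Ioo.2 hl)
  exact ⟨s, hlU hs, hps⟩

lemma frequently_nhdsGT_of_ae {p : ℝ → Prop} (hp : ∀ᵐ s, p s) (t : ℝ) : ∃ᶠ s in 𝓝[>] t, p s := by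
  rw [frequently_iff]
  intro U hU
  obtain ⟨l, hl, hlU⟩ := mem_nhdsGT_iff_exists_Ioo_subset.1 hU
  obtain ⟨s, hs, hps⟩ := (Measure.dense_of_ae hp).inter_open_nonempty _ isOpen_Ioo
    (nonempty_Ioo.2 hl)
  exact ⟨s, hlU hs, hps⟩

variable {X : Type*} [NormedAddCommGroup X] {T : ℝ} {u : ℝ → X} {Et : ℝ → X → ℝ}

lemma tendsto_prodMk_nhdsWithin {l : Filter ℝ} {t : ℝ} {L : X} (hl : l ≤ 𝓝 t)
    (hlT : ∀ᶠ s in l, s ∈ Icc 0 T) (hu : Tendsto u l (𝓝 L)) :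
    Tendsto (fun s => (s, u s)) l (𝓝[Icc (0 : ℝ) T ×ˢ (univ : Set X)] (t, L)) := by
  refine tendsto_nhdsWithin_iff.2 ⟨?_, ?_⟩
  · rw [nhds_prod_eq]
    exact Tendsto.prodMk hl hu
  · filter_upwards [hlT] with s hs using ⟨hs, mem_univ _⟩

lemma abs_integral_sub_mul_le {f : ℝ → ℝ} {s t c ε : ℝ} (hst : s ≤ t)
    (hf : IntervalIntegrable f volume s t) (h : ∀ r ∈ Ioo s t, |f r - c| ≤ ε) :
    |(∫ r in s..t, f r) - c * (t - s)| ≤ ε * (t - s) := by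
  have h1 : (∫ r in s..t, f r) - c * (t - s) = ∫ r in s..t, (f r - c) := by
    rw [intervalIntegral.integral_sub hf intervalIntegrable_const,
      intervalIntegral.integral_const, smul_eq_mul, mul_comm c]
  rw [h1, ← abs_of_nonneg (sub_nonneg.2 hst), ← Real.norm_eq_abs (∫ r in s..t, (f r - c))]
  refine intervalIntegral.norm_integral_le_of_norm_le_const_ae ?_
  filter_upwards [Measure.ae_ne volume t] with r hrt hr
  rw [uIoc_of_le hst] at hr
  exact h r ⟨hr.1, lt_of_le_of_ne hr.2 hrt⟩

lemma eventually_abs_time_increment_le {E : ℝ → X → ℝ}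
    (hEt : ∀ x : X, ∀ t ∈ Icc (0:ℝ) T,
      HasDerivWithinAt (fun s => E s x) (Et t x) (Icc 0 T) t)
    (hEtc : ContinuousOn (fun p : ℝ × X => Et p.1 p.2) (Icc 0 T ×ˢ univ))
    {t : ℝ} (ht : t ∈ Icc 0 T) (L : X) {ε : ℝ} (hε : 0 < ε) :
    ∀ᶠ p in 𝓝[Icc (0 : ℝ) T ×ˢ (univ : Set X)] (t, L),
      |E t p.2 - E p.1 p.2 - Et t L * (t - p.1)| ≤ ε * |t - p.1| := by
  obtain ⟨δ, hδ, h⟩ := Metric.continuousWithinAt_iff.1 (hEtc (t, L) ⟨ht, mem_univ _⟩) ε hε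
  filter_upwards [self_mem_nhdsWithin, mem_nhdsWithin_of_mem_nhds (Metric.ball_mem_nhds _ hδ)]
    with p hp hpδ
  rw [Metric.mem_ball, Prod.dist_eq, max_lt_iff] at hpδ
  have hsub : uIcc p.1 t ⊆ Icc 0 T := uIcc_subset_Icc hp.1 ht
  have key := Convex.norm_image_sub_le_of_norm_hasDerivWithin_le
    (f := fun r => E r p.2 - Et t L * r) (f' := fun r => Et r p.2 - Et t L) (s := uIcc p.1 t)
    (x := p.1) (y := t) (C := ε) (fun r hr => ?_) (fun r hr => ?_) (convex_uIcc _ _)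
    left_mem_uIcc right_mem_uIcc
  · rw [Real.norm_eq_abs, Real.norm_eq_abs] at key
    convert key using 2
    ring
  · have h2 := ((hasDerivAt_id r).const_mul (Et t L)).hasDerivWithinAt (s := uIcc p.1 t)
    rw [mul_one] at h2
    exact ((hEt p.2 r (hsub hr)).mono hsub).fun_sub h2
  · refine (h (x := (r, p.2)) ⟨hsub hr, mem_univ _⟩ ?_).le
    rw [Prod.dist_eq, max_lt_iff]
    refine ⟨lt_of_le_of_lt ?_ hpδ.1, hpδ.2⟩
    have := Set.abs_sub_right_of_mem_uIcc hr
    rw [Real.dist_eq, Real.dist_eq, abs_sub_comm r, abs_sub_comm p.1]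
    exact this

variable [NormedSpace ℝ X] {Ψ : X → ℝ} {DE : ℝ → X → X →L[ℝ] ℝ}

lemma neg_mem_subdiffZero_of_tendsto {l : Filter ℝ} {A : ℝ → X →L[ℝ] ℝ} {ξ : X →L[ℝ] ℝ}
    (hfreq : ∃ᶠ s in l, -A s ∈ subdiffZero Ψ) (h : Tendsto A l (𝓝 ξ)) :
    -ξ ∈ subdiffZero Ψ := fun v => by
  refine le_of_tendsto_of_frequently
    (((ContinuousLinearMap.apply ℝ ℝ v).continuous.tendsto _).comp h.neg) ?_
  exact hfreq.mono fun s hs => hs v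

lemma eventually_le_of_neg_mem_subdiffZero {e : X → ℝ} {ξ : X →L[ℝ] ℝ} {L : X}
    (he : HasFDerivAt e ξ L) (hξ : -ξ ∈ subdiffZero Ψ) {ε : ℝ} (hε : 0 < ε) :
    ∀ᶠ x in 𝓝 L, -Ψ (x - L) - ε * ‖x - L‖ ≤ e x - e L ∧
      -Ψ (L - x) - ε * ‖x - L‖ ≤ e L - e x := by
  filter_upwards [he.isLittleO.def hε] with x hx
  rw [Real.norm_eq_abs, abs_le] at hx
  have h1 := hξ (x - L)
  have h2 := hξ (L - x)
  rw [neg_apply] at h1 h2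
  rw [← neg_sub x L, map_neg] at h2
  rw [← neg_sub x L]
  constructor <;> linarith [hx.1, hx.2]

variable {E : ℝ → X → ℝ}

lemma eventually_le_energy_increment_nhdsLT
    (hEt : ∀ x : X, ∀ t ∈ Icc (0:ℝ) T,
      HasDerivWithinAt (fun s => E s x) (Et t x) (Icc 0 T) t)
    (hEtc : ContinuousOn (fun p : ℝ × X => Et p.1 p.2) (Icc 0 T ×ˢ univ))
    (hint : IntegrableOn (fun r => Et r (u r)) (Icc 0 T))
    {t : ℝ} (ht : t ∈ Ioc 0 T) {L : X} (hL : Tendsto u (𝓝[<] t) (𝓝 L)) {ξ : X →L[ℝ] ℝ}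
    (hξ : HasFDerivAt (E t) ξ L) (hstab : -ξ ∈ subdiffZero Ψ) {ε : ℝ} (hε : 0 < ε) :
    ∀ᶠ s in 𝓝[<] t, (∫ r in s..t, Et r (u r)) - Ψ (L - u s) - ε * ‖u s - L‖ - ε * (t - s) ≤
      E t L - E s (u s) := by
  have htT : t ∈ Icc 0 T := Ioc_subset_Icc_self ht
  have hIoo := Ioo_mem_nhdsLT ht.1
  have hpair := tendsto_prodMk_nhdsWithin (T := T) (nhdsWithin_le_nhds (s := Iio t))
    (by filter_upwards [hIoo] with s hs using ⟨hs.1.le, hs.2.le.trans ht.2⟩) hL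
  have hf : Tendsto (fun r => Et r (u r)) (𝓝[<] t) (𝓝 (Et t L)) :=
    (hEtc (t, L) ⟨htT, mem_univ _⟩).tendsto.comp hpair
  obtain ⟨l, hlt, hl⟩ := mem_nhdsLT_iff_exists_Ioo_subset.1
    (hf.eventually (Metric.closedBall_mem_nhds _ (half_pos hε)))
  filter_upwards [hIoo, Ioo_mem_nhdsLT hlt,
    hpair.eventually (eventually_abs_time_increment_le hEt hEtc htT L (half_pos hε)),
    hL.eventually (eventually_le_of_neg_mem_subdiffZero hξ hstab hε)] with s hs hls h1 h2
  have h3 := abs_integral_sub_mul_le (c := Et t L) (ε := ε / 2) hs.2.le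
    ((intervalIntegrable_iff_integrableOn_Icc_of_le hs.2.le).2
      (hint.mono_set (Icc_subset_Icc hs.1.le ht.2)))
    fun r hr => by simpa [Real.dist_eq] using hl ⟨hls.1.trans hr.1, hr.2⟩
  rw [abs_of_pos (sub_pos.2 hs.2), abs_le] at h1
  rw [abs_le] at h3
  linarith [h1.1, h3.2, h2.2]

lemma eventually_le_energy_increment_nhdsGT
    (hEt : ∀ x : X, ∀ t ∈ Icc (0:ℝ) T,
      HasDerivWithinAt (fun s => E s x) (Et t x) (Icc 0 T) t)
    (hEtc : ContinuousOn (fun p : ℝ × X => Et p.1 p.2) (Icc 0 T ×ˢ univ))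
    (hint : IntegrableOn (fun r => Et r (u r)) (Icc 0 T))
    {t : ℝ} (ht : t ∈ Ico 0 T) {R : X} (hR : Tendsto u (𝓝[>] t) (𝓝 R)) {ξ : X →L[ℝ] ℝ}
    (hξ : HasFDerivAt (E t) ξ R) (hstab : -ξ ∈ subdiffZero Ψ) {ε : ℝ} (hε : 0 < ε) :
    ∀ᶠ s in 𝓝[>] t, (∫ r in t..s, Et r (u r)) - Ψ (u s - R) - ε * ‖u s - R‖ - ε * (s - t) ≤
      E s (u s) - E t R := by
  have htT : t ∈ Icc 0 T := Ico_subset_Icc_self ht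
  have hIoo := Ioo_mem_nhdsGT ht.2
  have hpair := tendsto_prodMk_nhdsWithin (T := T) (nhdsWithin_le_nhds (s := Ioi t))
    (by filter_upwards [hIoo] with s hs using ⟨ht.1.trans hs.1.le, hs.2.le⟩) hR
  have hf : Tendsto (fun r => Et r (u r)) (𝓝[>] t) (𝓝 (Et t R)) :=
    (hEtc (t, R) ⟨htT, mem_univ _⟩).tendsto.comp hpair
  obtain ⟨l, hlt, hl⟩ := mem_nhdsGT_iff_exists_Ioo_subset.1
    (hf.eventually (Metric.closedBall_mem_nhds _ (half_pos hε)))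
  filter_upwards [hIoo, Ioo_mem_nhdsGT hlt,
    hpair.eventually (eventually_abs_time_increment_le hEt hEtc htT R (half_pos hε)),
    hR.eventually (eventually_le_of_neg_mem_subdiffZero hξ hstab hε)] with s hs hls h1 h2
  have h3 := abs_integral_sub_mul_le (c := Et t R) (ε := ε / 2) hs.1.le
    ((intervalIntegrable_iff_integrableOn_Icc_of_le hs.1.le).2
      (hint.mono_set (Icc_subset_Icc ht.1 hs.2.le)))
    fun r hr => by simpa [Real.dist_eq] using hl ⟨hr.1, hr.2.trans hls.2⟩
  rw [abs_sub_comm t, abs_of_pos (sub_pos.2 hs.1), abs_le] at h1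
  rw [abs_le] at h3
  linarith [h1.2, h3.2, h2.1]

end EnergyIncrements

section Integrability

variable {X : Type*} [NormedAddCommGroup X] {T : ℝ} {u : ℝ → X} {V : ℝ → ℝ}

lemma abs_norm_sub_le_of_norm_le_sub
    (hV : ∀ s t, 0 ≤ s → s < t → t ≤ T → ‖u t - u s‖ ≤ V t - V s)
    {s t : ℝ} (hs : s ∈ Icc 0 T) (ht : t ∈ Icc 0 T) : ‖u t - u s‖ ≤ |V t - V s| := by
  rcases lt_trichotomy s t with h | rfl | h
  · exact (hV s t hs.1 h ht.2).trans (le_abs_self _)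
  · simp
  · rw [norm_sub_rev, abs_sub_comm]
    exact (hV t s ht.1 h hs.2).trans (le_abs_self _)

lemma monotoneOn_of_norm_le_sub
    (hV : ∀ s t, 0 ≤ s → s < t → t ≤ T → ‖u t - u s‖ ≤ V t - V s) : MonotoneOn V (Icc 0 T) := by
  intro s hs t ht hst
  rcases hst.eq_or_lt with rfl | hst
  · exact le_rfl
  · linarith [hV s t hs.1 hst ht.2, norm_nonneg (u t - u s)]

lemma norm_sub_le_of_norm_le_sub
    (hV : ∀ s t, 0 ≤ s → s < t → t ≤ T → ‖u t - u s‖ ≤ V t - V s) {t : ℝ} (ht : t ∈ Icc 0 T) :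
    ‖u t‖ ≤ ‖u 0‖ + (V T - V 0) := by
  have h0 : (0 : ℝ) ∈ Icc 0 T := ⟨le_rfl, ht.1.trans ht.2⟩
  have hT : T ∈ Icc 0 T := ⟨ht.1.trans ht.2, le_rfl⟩
  have hmono := monotoneOn_of_norm_le_sub hV
  have h1 := abs_norm_sub_le_of_norm_le_sub hV h0 ht
  rw [abs_of_nonneg (sub_nonneg.2 (hmono h0 ht ht.1))] at h1
  have h2 := hmono ht hT ht.2
  have h3 := norm_sub_norm_le (u t) (u 0)
  linarith

lemma integrableOn_comp_of_norm_le_sub [ProperSpace X] {Et : ℝ → X → ℝ}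
    (hEtc : ContinuousOn (fun p : ℝ × X => Et p.1 p.2) (Icc 0 T ×ˢ univ))
    (hV : ∀ s t, 0 ≤ s → s < t → t ≤ T → ‖u t - u s‖ ≤ V t - V s) :
    IntegrableOn (fun r => Et r (u r)) (Icc 0 T) := by
  obtain ⟨M, hM⟩ := (isCompact_Icc.prod
    (isCompact_closedBall (0 : X) (‖u 0‖ + (V T - V 0)))).exists_bound_of_continuousOn
    (hEtc.mono (prod_mono_right (subset_univ _)))
  have hmono := monotoneOn_of_norm_le_sub hV
  set f := fun r => Et r (u r)
  have hcont : ∀ r ∈ Ioo 0 T, ContinuousWithinAt V (Icc 0 T) r → ContinuousAt f r := by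
    intro r hr hVr
    have hrT := Ioo_subset_Icc_self hr
    have hnhds := Icc_mem_nhds hr.1 hr.2
    have hVr' : Tendsto V (𝓝 r) (𝓝 (V r)) := hVr.continuousAt hnhds
    have hu : Tendsto u (𝓝 r) (𝓝 (u r)) := by
      rw [tendsto_iff_norm_sub_tendsto_zero]
      have h1 : Tendsto (fun s => |V s - V r|) (𝓝 r) (𝓝 0) := by
        simpa using (hVr'.sub_const (V r)).abs
      refine squeeze_zero' (Eventually.of_forall fun _ => norm_nonneg _) ?_ h1
      filter_upwards [hnhds] with s hs using abs_norm_sub_le_of_norm_le_sub hV hrT hs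
    exact (hEtc (r, u r) ⟨hrT, mem_univ _⟩).tendsto.comp
      (tendsto_prodMk_nhdsWithin le_rfl hnhds hu)
  have hmeas : AEStronglyMeasurable f (volume.restrict (Icc 0 T)) := by
    have hC : MeasurableSet {r | ContinuousAt f r} := measurableSet_of_continuousAt f
    have h1 : AEStronglyMeasurable f (volume.restrict {r | ContinuousAt f r}) :=
      ContinuousOn.aestronglyMeasurable (fun r hr => ContinuousAt.continuousWithinAt hr) hC
    rw [← restrict_Ioo_eq_restrict_Icc]
    refine h1.mono_measure (Measure.restrict_mono_ae ?_)
    filter_upwards [hmono.countable_not_continuousWithinAt.ae_notMem volume] with r hr hrT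
    exact hcont r hrT (by_contra fun h => hr ⟨Ioo_subset_Icc_self hrT, h⟩)
  refine MeasureTheory.Integrable.of_bound hmeas M ?_
  filter_upwards [ae_restrict_mem measurableSet_Icc] with r hr
  refine hM (r, u r) ⟨hr, ?_⟩
  simpa using norm_sub_le_of_norm_le_sub hV hr

end Integrability

section BalanceInequality

variable {F D W : ℝ → ℝ} {cL cR : ℝ → ℝ} {a b : ℝ}

lemma le_add_tsum_of_eventually_le (hab : a ≤ b) (hW : W a ≤ W b)
    (hcL : ∀ t ∈ Ioc a b, 0 ≤ cL t) (hcR : ∀ t ∈ Ico a b, 0 ≤ cR t)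
    (hsL : Summable ((Ioc a b).indicator cL)) (hsR : Summable ((Ico a b).indicator cR))
    (hl : ∀ ε > 0, ∀ t ∈ Ioc a b, ∀ᶠ s in 𝓝[<] t, a ≤ s →
      F s ≤ F t + (D t - D s) + cL t + ε * (W t - W s))
    (hr : ∀ ε > 0, ∀ t ∈ Ico a b, ∀ᶠ s in 𝓝[>] t, s ≤ b →
      F t ≤ F s + (D s - D t) + cR t + ε * (W s - W t)) :
    F a ≤ F b + (D b - D a) + ∑' r, (Ioc a b).indicator cL r + ∑' r, (Ico a b).indicator cR r := by
  refine le_of_forall_pos_le_add fun δ hδ => ?_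
  have hd : 0 < W b - W a + 1 := by linarith
  set ε := δ / (W b - W a + 1) with hε_def
  have hε : 0 < ε := div_pos hδ hd
  have key := le_of_eventually_le_nhdsLT_nhdsGT hab (Φ := fun t => F t + D t +
    ∑' r, (Ioc a t).indicator cL r + ∑' r, (Ico a t).indicator cR r + ε * W t) ?_ ?_
  · have hεδ : ε * (W b - W a) ≤ δ := by
      have : ε * (W b - W a + 1) = δ := div_mul_cancel₀ _ hd.ne'
      linarith
    simp only [Ioc_self, Ico_self, indicator_empty, tsum_zero] at key
    linarith
  · intro t ht
    filter_upwards [hl ε hε t ht, self_mem_nhdsWithin] with s hs hst has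
    have hst : s < t := hst
    have hLt : Ioc a t ⊆ Ioc a b := Ioc_subset_Ioc_right ht.2
    have hRt : Ico a t ⊆ Ico a b := Ico_subset_Ico_right ht.2
    have h1 := tsum_indicator_add_le (A := Ioc a s) (x := t) (fun r hr => hcL r (hLt hr))
      (summable_indicator_mono hLt hsL) (Ioc_subset_Ioc_right hst.le) (fun h => hst.not_ge h.2)
      ⟨ht.1, le_rfl⟩
    have h2 := tsum_indicator_mono (fun r hr => hcR r (hRt hr))
      (Ico_subset_Ico_right hst.le) (summable_indicator_mono hRt hsR)
    linarith [hs has]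
  · intro t ht
    filter_upwards [hr ε hε t ht, self_mem_nhdsWithin] with s hs hst hsb
    have hst : t < s := hst
    have hLs : Ioc a s ⊆ Ioc a b := Ioc_subset_Ioc_right hsb
    have hRs : Ico a s ⊆ Ico a b := Ico_subset_Ico_right hsb
    have h1 := tsum_indicator_add_le (A := Ico a t) (x := t) (fun r hr => hcR r (hRs hr))
      (summable_indicator_mono hRs hsR) (Ico_subset_Ico_right hst.le) (fun h => h.2.false)
      ⟨ht.1, hst⟩
    have h2 := tsum_indicator_mono (fun r hr => hcL r (hLs hr))
      (Ioc_subset_Ioc_right hst.le) (summable_indicator_mono hLs hsL)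
    linarith [hs hsb]

end BalanceInequality

section NewDissipation

variable {X : Type*} [NormedAddCommGroup X] [NormedSpace ℝ X] {DE : ℝ → X → X →L[ℝ] ℝ}
  {Ψ : X → ℝ} {u uL uR : ℝ → X}

lemma exists_deltaNew_le [ProperSpace X] {T : ℝ} (hΨnn : ∀ v, 0 ≤ Ψ v)
    (hDEc : ContinuousOn (fun p : ℝ × X => DE p.1 p.2) (Icc 0 T ×ˢ univ)) (R : ℝ) :
    ∃ M, 0 ≤ M ∧ ∀ t ∈ Icc 0 T, ∀ x y : X, ‖x‖ ≤ R → ‖y‖ ≤ R →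
      deltaNew DE Ψ t x y ≤ Ψ (y - x) + M * ‖y - x‖ := by
  obtain ⟨M, hM⟩ := (isCompact_Icc.prod (isCompact_closedBall (0 : X) R))
    |>.exists_bound_of_continuousOn (hDEc.mono (prod_mono_right (subset_univ _)))
  refine ⟨max M 0, le_max_right _ _, fun t ht x y hx hy => deltaNew_le hΨnn x y fun z hz => ?_⟩
  refine (hM (t, z) ⟨ht, ?_⟩).trans (le_max_left _ _)
  exact (convex_closedBall (0 : X) R).segment_subset (by simpa using hx) (by simpa using hy) hz

lemma dissNew_eq_add_tsum {t₀ t₁ : ℝ} (h : t₀ < t₁)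
    (hsL : Summable ((Ioc t₀ t₁).indicator
      fun r => deltaNew DE Ψ r (uL r) (u r) - Ψ (u r - uL r)))
    (hsR : Summable ((Ico t₀ t₁).indicator
      fun r => deltaNew DE Ψ r (u r) (uR r) - Ψ (uR r - u r)))
    (hL : ∀ r ∈ Ioo t₀ t₁, ContinuousAt u r →
      deltaNew DE Ψ r (uL r) (u r) - Ψ (u r - uL r) = 0)
    (hR : ∀ r ∈ Ioo t₀ t₁, ContinuousAt u r →
      deltaNew DE Ψ r (u r) (uR r) - Ψ (uR r - u r) = 0) :
    dissNew DE Ψ u uL uR t₀ t₁ = dissTV Ψ u t₀ t₁ +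
      ∑' r, (Ioc t₀ t₁).indicator (fun r => deltaNew DE Ψ r (uL r) (u r) - Ψ (u r - uL r)) r +
      ∑' r, (Ico t₀ t₁).indicator (fun r => deltaNew DE Ψ r (u r) (uR r) - Ψ (uR r - u r)) r := by
  set cL := fun r => deltaNew DE Ψ r (uL r) (u r) - Ψ (u r - uL r)
  set cR := fun r => deltaNew DE Ψ r (u r) (uR r) - Ψ (uR r - u r)
  have hsL' := summable_indicator_mono Ioo_subset_Ioc_self hsL
  have hsR' := summable_indicator_mono Ioo_subset_Ico_self hsR
  rw [← Ioo_insert_right h, ← Ioo_insert_left h, tsum_indicator_insert (by simp) hsL',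
    tsum_indicator_insert (by simp) hsR', dissNew,
    tsum_subtype ({s | ¬ContinuousAt u s} ∩ Ioo t₀ t₁) fun r => deltaNew DE Ψ r (uL r) (u r) +
      deltaNew DE Ψ r (u r) (uR r) - Ψ (u r - uL r) - Ψ (uR r - u r)]
  have hsum : (({s | ¬ContinuousAt u s} ∩ Ioo t₀ t₁).indicator fun r =>
      deltaNew DE Ψ r (uL r) (u r) + deltaNew DE Ψ r (u r) (uR r) - Ψ (u r - uL r)
        - Ψ (uR r - u r)) =
      fun r => (Ioo t₀ t₁).indicator cL r + (Ioo t₀ t₁).indicator cR r := by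
    ext r
    by_cases hr : r ∈ Ioo t₀ t₁
    · by_cases hu : ContinuousAt u r
      · rw [indicator_of_notMem (fun h => h.1 hu), indicator_of_mem hr, indicator_of_mem hr]
        linarith [hL r hr hu, hR r hr hu]
      · have hmem : r ∈ {s | ¬ContinuousAt u s} ∩ Ioo t₀ t₁ := ⟨hu, hr⟩
        rw [indicator_of_mem hmem, indicator_of_mem hr, indicator_of_mem hr]
        ring
    · rw [indicator_of_notMem (fun h => hr h.2), indicator_of_notMem hr, indicator_of_notMem hr,
        add_zero]
  rw [hsum, hsL'.tsum_add hsR']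
  ring

end NewDissipation
theorem stmt_12
    {X : Type*} [NormedAddCommGroup X] [NormedSpace ℝ X] [FiniteDimensional ℝ X]
    [Nontrivial X]
    (T : ℝ) (hT : 0 < T)
    (E Et : ℝ → X → ℝ) (DE : ℝ → X → X →L[ℝ] ℝ)
    (hEnn : ∀ t ∈ Set.Icc (0:ℝ) T, ∀ x : X, 0 ≤ E t x)
    (hEt : ∀ x : X, ∀ t ∈ Set.Icc (0:ℝ) T,
      HasDerivWithinAt (fun s => E s x) (Et t x) (Set.Icc 0 T) t)
    (hDE : ∀ t ∈ Set.Icc (0:ℝ) T, ∀ x : X, HasFDerivAt (fun y => E t y) (DE t x) x)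
    (hEtc : ContinuousOn (fun p : ℝ × X => Et p.1 p.2) (Set.Icc 0 T ×ˢ Set.univ))
    (hDEc : ContinuousOn (fun p : ℝ × X => DE p.1 p.2) (Set.Icc 0 T ×ˢ Set.univ))
    (Ψ : X → ℝ) (hΨnn : ∀ v, 0 ≤ Ψ v) (hΨconv : ConvexOn ℝ Set.univ Ψ)
    (hΨhom : ∀ c : ℝ, 0 ≤ c → ∀ v : X, Ψ (c • v) = c * Ψ v)
    (hΨpos : ∀ v : X, v ≠ 0 → 0 < Ψ v)
    (u uL uR : ℝ → X)
    (hBV : BddAbove (dissSums (fun v : X => ‖v‖) u 0 T))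
    (huL : ∀ t ∈ Set.Ioc (0:ℝ) T,
      Filter.Tendsto u (nhdsWithin t (Set.Iio t)) (nhds (uL t)))
    (huL0 : uL 0 = u 0)
    (huR : ∀ t ∈ Set.Ico (0:ℝ) T,
      Filter.Tendsto u (nhdsWithin t (Set.Ioi t)) (nhds (uR t)))
    (huRT : uR T = u T)
    (hstab : ∀ᵐ t ∂(MeasureTheory.volume : MeasureTheory.Measure ℝ),
      t ∈ Set.Ioo (0:ℝ) T → -(DE t (u t)) ∈ subdiffZero Ψ) :
    ∀ t₀ t₁ : ℝ, 0 ≤ t₀ → t₀ < t₁ → t₁ ≤ T →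
      E t₁ (u t₁) - E t₀ (u t₀) ≥
        (∫ s in t₀..t₁, Et s (u s)) - dissNew DE Ψ u uL uR t₀ t₁ := by
  intro t₀ t₁ h0 h01 h1T
  have := FiniteDimensional.proper ℝ X
  have hΨc : Continuous Ψ := hΨconv.locallyLipschitz.continuous
  have hDEx : ∀ t ∈ Icc 0 T, Continuous (DE t) := fun t ht =>
    continuousOn_univ.1 (hDEc.comp (f := fun x => (t, x)) (by fun_prop) fun x _ => ⟨ht, mem_univ _⟩)
  have hsubT : Icc t₀ t₁ ⊆ Icc 0 T := Icc_subset_Icc h0 h1T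
  -- the total variation `V` and the dissipation `D` control the increments of `u`
  set V := dissTV (fun v : X => ‖v‖) u 0
  have hV : ∀ s t, 0 ≤ s → s < t → t ≤ T → ‖u t - u s‖ ≤ V t - V s := fun s t hs hst ht =>
    le_dissTV_sub (g := fun v : X => ‖v‖) hs hst (bddAbove_dissSums_mono norm_nonneg ht hBV)
  have hVmono := monotoneOn_of_norm_le_sub hV
  set D := dissTV Ψ u t₀
  have hD : ∀ s t, t₀ ≤ s → s < t → t ≤ t₁ → Ψ (u t - u s) ≤ D t - D s := by
    obtain ⟨C, hC0, hC⟩ := exists_le_mul_norm hΨc hΨhom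
    have hbdd : BddAbove (dissSums Ψ u t₀ t₁) :=
      bddAbove_dissSums_of_le_sub (W := fun t => C * V t) fun s t hs hst ht => by
        rw [← mul_sub]
        exact (hC _).trans (mul_le_mul_of_nonneg_left (hV s t (h0.trans hs) hst (ht.trans h1T)) hC0)
    exact fun s t hs hst ht => le_dissTV_sub hs hst (bddAbove_dissSums_mono hΨnn ht hbdd)
  have hint := integrableOn_comp_of_norm_le_sub hEtc hV
  -- the one-sided limits of `u` are stable
  have hstabL : ∀ t ∈ Ioc 0 T, -DE t (uL t) ∈ subdiffZero Ψ := fun t ht => by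
    refine neg_mem_subdiffZero_of_tendsto (l := 𝓝[<] t) (A := fun s => DE s (u s)) ?_
      ((hDEc (t, uL t) ⟨Ioc_subset_Icc_self ht, mem_univ _⟩).tendsto.comp
        (tendsto_prodMk_nhdsWithin nhdsWithin_le_nhds ?_ (huL t ht)))
    · exact ((frequently_nhdsLT_of_ae hstab t).and_eventually (Ioo_mem_nhdsLT ht.1)).mono
        fun s hs => hs.1 ⟨hs.2.1, hs.2.2.trans_le ht.2⟩
    · filter_upwards [Ioo_mem_nhdsLT ht.1] with s hs using ⟨hs.1.le, hs.2.le.trans ht.2⟩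
  have hstabR : ∀ t ∈ Ico 0 T, -DE t (uR t) ∈ subdiffZero Ψ := fun t ht => by
    refine neg_mem_subdiffZero_of_tendsto (l := 𝓝[>] t) (A := fun s => DE s (u s)) ?_
      ((hDEc (t, uR t) ⟨Ico_subset_Icc_self ht, mem_univ _⟩).tendsto.comp
        (tendsto_prodMk_nhdsWithin nhdsWithin_le_nhds ?_ (huR t ht)))
    · exact ((frequently_nhdsGT_of_ae hstab t).and_eventually (Ioo_mem_nhdsGT ht.2)).mono
        fun s hs => hs.1 ⟨ht.1.trans_lt hs.2.1, hs.2.2⟩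
    · filter_upwards [Ioo_mem_nhdsGT ht.2] with s hs using ⟨ht.1.trans hs.1.le, hs.2.le⟩
  -- the corrections at the jumps are nonnegative and dominated by the jumps of `V`
  set cL := fun r => deltaNew DE Ψ r (uL r) (u r) - Ψ (u r - uL r) with hcL_def
  set cR := fun r => deltaNew DE Ψ r (u r) (uR r) - Ψ (uR r - u r) with hcR_def
  have hcL : ∀ t ∈ Icc t₀ t₁, 0 ≤ cL t := fun t ht =>
    sub_nonneg.2 (le_deltaNew hΨconv hΨnn hΨc hΨhom (hDEx t (hsubT ht)) _ _)
  have hcR : ∀ t ∈ Icc t₀ t₁, 0 ≤ cR t := fun t ht =>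
    sub_nonneg.2 (le_deltaNew hΨconv hΨnn hΨc hΨhom (hDEx t (hsubT ht)) _ _)
  have hu_le : ∀ t ∈ Icc 0 T, ‖u t‖ ≤ ‖u 0‖ + (V T - V 0) :=
    fun t ht => norm_sub_le_of_norm_le_sub hV ht
  obtain ⟨M, hM0, hM⟩ := exists_deltaNew_le hΨnn hDEc (‖u 0‖ + (V T - V 0))
  have hcL_le : ∀ t ∈ Ioc t₀ t₁, cL t ≤ M * ‖u t - uL t‖ := fun t ht => by
    have ht' : t ∈ Ioc 0 T := ⟨h0.trans_lt ht.1, ht.2.trans h1T⟩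
    have hL : ‖uL t‖ ≤ ‖u 0‖ + (V T - V 0) := by
      refine le_of_tendsto (huL t ht').norm ?_
      filter_upwards [Ioo_mem_nhdsLT ht'.1] with s hs using hu_le s ⟨hs.1.le, hs.2.le.trans ht'.2⟩
    have := hM t (Ioc_subset_Icc_self ht') _ _ hL (hu_le t (Ioc_subset_Icc_self ht'))
    simp only [hcL_def]
    linarith
  have hcR_le : ∀ t ∈ Ico t₀ t₁, cR t ≤ M * ‖uR t - u t‖ := fun t ht => by
    have ht' : t ∈ Ico 0 T := ⟨h0.trans ht.1, ht.2.trans_le h1T⟩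
    have hR : ‖uR t‖ ≤ ‖u 0‖ + (V T - V 0) := by
      refine le_of_tendsto (huR t ht').norm ?_
      filter_upwards [Ioo_mem_nhdsGT ht'.2] with s hs using hu_le s ⟨ht'.1.trans hs.1.le, hs.2.le⟩
    have := hM t (Ico_subset_Icc_self ht') _ _ (hu_le t (Ico_subset_Icc_self ht')) hR
    simp only [hcR_def]
    linarith
  have hMV : MonotoneOn (fun t => M * V t) (Icc t₀ t₁) := fun s hs t ht hst =>
    mul_le_mul_of_nonneg_left (hVmono (hsubT hs) (hsubT ht) hst) hM0
  have hsL : Summable ((Ioc t₀ t₁).indicator cL) := by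
    refine summable_indicator_of_sum_le (fun t ht => hcL t (Ioc_subset_Icc_self ht)) fun F hF =>
      sum_le_sub_of_forall_Ico h01.le hMV (fun t ht s hs => ?_) F hF
    have h1 := add_le_sub_of_tendsto_nhdsLT continuous_norm hV (h0.trans hs.1) hs.2
      (ht.2.trans h1T) (huL t ⟨h0.trans_lt ht.1, ht.2.trans h1T⟩)
    rw [← mul_sub]
    refine (hcL_le t ht).trans (mul_le_mul_of_nonneg_left ?_ hM0)
    linarith [norm_nonneg (uL t - u s)]
  have hsR : Summable ((Ico t₀ t₁).indicator cR) := by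
    refine summable_indicator_of_sum_le (fun t ht => hcR t (Ico_subset_Icc_self ht)) fun F hF =>
      sum_le_sub_of_forall_Ioc h01.le hMV (fun t ht s hs => ?_) F hF
    have h1 := add_le_sub_of_tendsto_nhdsGT continuous_norm hV (h0.trans ht.1) hs.1
      (hs.2.trans h1T) (huR t ⟨h0.trans ht.1, ht.2.trans_le h1T⟩)
    rw [← mul_sub]
    refine (hcR_le t ht).trans (mul_le_mul_of_nonneg_left ?_ hM0)
    linarith [norm_nonneg (u s - uR t)]
  have hint' : ∀ {s t}, t₀ ≤ s → s ≤ t → t ≤ t₁ →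
      IntervalIntegrable (fun r => Et r (u r)) volume s t := fun hs hst ht =>
    (intervalIntegrable_iff_integrableOn_Icc_of_le hst).2
      (hint.mono_set (Icc_subset_Icc (h0.trans hs) (ht.trans h1T)))
  have key := le_add_tsum_of_eventually_le
    (F := fun t => E t (u t) - ∫ r in t₀..t, Et r (u r)) (D := D) (W := fun t => V t + t)
    h01.le ?_ (fun t ht => hcL t (Ioc_subset_Icc_self ht))
    (fun t ht => hcR t (Ico_subset_Icc_self ht)) hsL hsR ?_ ?_
  · rw [dissNew_eq_add_tsum h01 hsL hsR]
    · have hD0 : 0 ≤ D t₀ := dissTV_nonneg hΨnn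
      simp only [intervalIntegral.integral_same] at key
      change _ ≥ _ - (D t₁ + _ + _)
      linarith
    · intro r hr hu
      have hL : u r = uL r := tendsto_nhds_unique (hu.tendsto.mono_left nhdsWithin_le_nhds)
        (huL r ⟨h0.trans_lt hr.1, hr.2.le.trans h1T⟩)
      have := hcL_le r (Ioo_subset_Ioc_self hr)
      rw [hL, sub_self, norm_zero, mul_zero] at this
      exact le_antisymm this (hcL r (Ioo_subset_Icc_self hr))
    · intro r hr hu
      have hR : u r = uR r := tendsto_nhds_unique (hu.tendsto.mono_left nhdsWithin_le_nhds)
        (huR r ⟨h0.trans hr.1.le, hr.2.trans_le h1T⟩)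
      have := hcR_le r (Ioo_subset_Ico_self hr)
      rw [← hR, sub_self, norm_zero, mul_zero] at this
      exact le_antisymm this (hcR r (Ioo_subset_Icc_self hr))
  · exact add_le_add (hVmono (hsubT (left_mem_Icc.2 h01.le)) (hsubT (right_mem_Icc.2 h01.le))
      h01.le) h01.le
  · intro ε hε t ht
    have ht' : t ∈ Ioc 0 T := ⟨h0.trans_lt ht.1, ht.2.trans h1T⟩
    have htT := Ioc_subset_Icc_self ht'
    filter_upwards [self_mem_nhdsWithin, eventually_le_energy_increment_nhdsLT hEt hEtc hint ht'
      (huL t ht') (hDE t htT _) (hstabL t ht') hε] with s hst hE hs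
    have h1 := sub_le_deltaNew hΨnn hΨc hΨhom (hDEx t htT) (hDE t htT) (uL t) (u t)
    have h2 := add_le_sub_of_tendsto_nhdsLT hΨc hD hs hst ht.2 (huL t ht')
    have h3 := add_le_sub_of_tendsto_nhdsLT continuous_norm hV (h0.trans hs) hst ht'.2 (huL t ht')
    have h4 := intervalIntegral.integral_add_adjacent_intervals
      (hint' le_rfl hs (hst.le.trans ht.2)) (hint' hs (le_of_lt hst) ht.2)
    have h5 : ε * ‖u s - uL t‖ ≤ ε * (V t - V s) := by
      rw [norm_sub_rev]
      exact mul_le_mul_of_nonneg_left (by linarith [norm_nonneg (u t - uL t)]) hε.le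
    simp only [hcL_def]
    linarith
  · intro ε hε t ht
    have ht' : t ∈ Ico 0 T := ⟨h0.trans ht.1, ht.2.trans_le h1T⟩
    have htT := Ico_subset_Icc_self ht'
    filter_upwards [self_mem_nhdsWithin, eventually_le_energy_increment_nhdsGT hEt hEtc hint ht'
      (huR t ht') (hDE t htT _) (hstabR t ht') hε] with s hts hE hs
    have h1 := sub_le_deltaNew hΨnn hΨc hΨhom (hDEx t htT) (hDE t htT) (u t) (uR t)
    have h2 := add_le_sub_of_tendsto_nhdsGT hΨc hD ht.1 hts hs (huR t ht')
    have h3 := add_le_sub_of_tendsto_nhdsGT continuous_norm hV ht'.1 hts (hs.trans h1T) (huR t ht')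
    have h4 := intervalIntegral.integral_add_adjacent_intervals
      (hint' le_rfl ht.1 (hts.le.trans hs)) (hint' ht.1 (le_of_lt hts) hs)
    have h5 : ε * ‖u s - uR t‖ ≤ ε * (V s - V t) :=
      mul_le_mul_of_nonneg_left (by linarith [norm_nonneg (uR t - u t)]) hε.le
    simp only [hcR_def]
    linarith
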